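/- Under the standing assumptions, suppose R ∈ OR and R ∈ PD, and let t : (0, ∞) → (0, ∞) satisfy: (i) limsup_{u→∞} t(u)/u^{1/γ} < ∞, and (ii) for every ε > 0, limsup_{u→∞} P{ inf_{s∈[0,1]} X(s) < −ε (t(u) u^{−1/γ})^{−H} u^{1−H/γ} } / R(u^{1−H/γ}) < ∞. Then for every t̂ : (0, ∞) → [0, ∞) with 0 ≤ t̂(u) ≤ t(u) for all u: 1 ≤ liminf_{u→∞} P{ sup_{s∈[0, t(u)]} Y(s) > u } / P{ Y(t̂(u)) > u } ≤ limsup_{u→∞} P{ sup_{s∈[0, t(u)]} Y(s) > u } / P{ Y(t̂(u)) > u } < ∞. -/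

import Mathlib

open MeasureTheory Filter Set

noncomputable section

lemma aux_path (f : ℝ → ℝ) (hf : ∀ t : ℝ, 0 ≤ t → ContinuousWithinAt f (Ici t) t)
    (S : Set ℝ) (hS0 : ∀ s ∈ S, 0 ≤ s) (B : ℝ)
    (hSr : ∀ s ∈ S, s = B ∨ ∃ e, s < e ∧ Ioo s e ⊆ S) (b : ℝ → ℝ) (hb : Continuous b) :
    (∃ s ∈ S, b s < f s) ↔ ∃ s ∈ S ∩ (range ((↑) : ℚ → ℝ) ∪ {B}), b s < f s := by
  constructor
  · rintro ⟨s, hs, hlt⟩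
    rcases hSr s hs with rfl | ⟨e, he, hsub⟩
    · exact ⟨s, ⟨hs, Or.inr rfl⟩, hlt⟩
    · have h1 : ContinuousWithinAt (fun x => f x - b x) (Ioi s) s :=
        ((hf s (hS0 s hs)).mono Ioi_subset_Ici_self).sub hb.continuousWithinAt
      have h2 : ∀ᶠ x in nhdsWithin s (Ioi s), 0 < f x - b x :=
        h1.eventually (lt_mem_nhds (by linarith))
      have h3 := (h2.and (Ioo_mem_nhdsGT he))
      obtain ⟨e', he', hsub'⟩ := (mem_nhdsGT_iff_exists_Ioo_subset).1 h3
      obtain ⟨q, hq1, hq2⟩ := exists_rat_btwn (show s < e' from he')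
      have := hsub' ⟨hq1, hq2⟩
      exact ⟨q, ⟨hsub this.2, Or.inl ⟨q, rfl⟩⟩, by linarith [this.1]⟩
  · rintro ⟨s, hs, hlt⟩
    exact ⟨s, hs.1, hlt⟩

lemma aux_scale {Ω : Type*} [MeasurableSpace Ω] (P : Measure Ω)
    (X : ℝ → Ω → ℝ) (H : ℝ) (hm : ∀ s, Measurable (X s))
    (hrc : ∀ᵐ ω ∂P, ∀ t : ℝ, 0 ≤ t → ContinuousWithinAt (fun s => X s ω) (Ici t) t)
    (hss : ∀ a : ℝ, 0 < a → ∀ n : ℕ, ∀ ts : Fin n → ℝ, (∀ i, 0 ≤ ts i) →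
      Measure.map (fun ω (i : Fin n) => a ^ (-H) * X (a * ts i) ω) P =
        Measure.map (fun ω (i : Fin n) => X (ts i) ω) P)
    (a : ℝ) (ha : 0 < a) (S : Set ℝ) (hS0 : ∀ s ∈ S, 0 ≤ s) (B : ℝ)
    (hSr : ∀ s ∈ S, s = B ∨ ∃ e, s < e ∧ Ioo s e ⊆ S) (b : ℝ → ℝ) (hb : Continuous b) :
    P {ω | ∃ s ∈ S, a ^ H * b s < X (a * s) ω} = P {ω | ∃ s ∈ S, b s < X s ω} := by
  have hiff : ∀ (x y : ℝ), a ^ H * x < y ↔ x < a ^ (-H) * y := by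
    intro x y
    rw [Real.rpow_neg ha.le, inv_mul_eq_div, lt_div_iff₀ (Real.rpow_pos_of_pos ha H), mul_comm]
  simp only [hiff]
  set D := S ∩ (range ((↑) : ℚ → ℝ) ∪ {B}) with hD
  have h1 : P {ω | ∃ s ∈ S, b s < a ^ (-H) * X (a * s) ω} =
      P {ω | ∃ s ∈ D, b s < a ^ (-H) * X (a * s) ω} := by
    apply measure_congr
    filter_upwards [hrc] with ω hω
    apply propext
    refine aux_path (fun s => a ^ (-H) * X (a * s) ω) ?_ S hS0 B hSr b hb
    intro t ht
    have h2 := hω (a * t) (by positivity)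
    have h3 : ContinuousWithinAt (fun s => X (a * s) ω) (Ici t) t := by
      refine ContinuousWithinAt.comp (g := fun s => X s ω) (f := fun s => a * s) h2
        (by fun_prop) ?_
      intro x hx
      exact mul_le_mul_of_nonneg_left hx ha.le
    exact h3.const_mul _
  have h2 : P {ω | ∃ s ∈ S, b s < X s ω} =
      P {ω | ∃ s ∈ D, b s < X s ω} := by
    apply measure_congr
    filter_upwards [hrc] with ω hω
    exact propext (aux_path (fun s => X s ω) hω S hS0 B hSr b hb)
  rw [h1, h2]
  have hDc : D.Countable := ((countable_range _).union (countable_singleton B)).mono inter_subset_right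
  rcases D.eq_empty_or_nonempty with hDe | hDn
  · simp [hDe]
  obtain ⟨ts, hts⟩ := hDc.exists_eq_range hDn
  have hts0 : ∀ n, 0 ≤ ts n := fun n => hS0 _ (by
    have : ts n ∈ D := by rw [hts]; exact mem_range_self n
    exact this.1)
  have key : ∀ n, P (accumulate (fun k => {ω | b (ts k) < a ^ (-H) * X (a * ts k) ω}) n) =
      P (accumulate (fun k => {ω | b (ts k) < X (ts k) ω}) n) := by
    intro n
    have h := hss a ha (n+1) (fun i => ts i) (fun i => hts0 i)
    have hset : MeasurableSet {x : Fin (n+1) → ℝ | ∃ i : Fin (n+1), b (ts i) < x i} := by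
      simp only [ofPred_exists]
      exact MeasurableSet.iUnion fun i => measurableSet_lt measurable_const (measurable_pi_apply i)
    have h' := congrArg (fun μ => μ {x : Fin (n+1) → ℝ | ∃ i : Fin (n+1), b (ts i) < x i}) h
    rw [Measure.map_apply (measurable_pi_lambda _ fun i => (hm _).const_mul _) hset,
      Measure.map_apply (measurable_pi_lambda _ fun i => hm _) hset] at h'
    convert h' using 2
    all_goals
      ext ω
      simp only [mem_accumulate, mem_ofPred_eq, mem_preimage]
      constructor
      · rintro ⟨k, hk, hlt⟩
        exact ⟨⟨k, by omega⟩, hlt⟩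
      · rintro ⟨i, hlt⟩
        exact ⟨i, by omega, hlt⟩
  have e1 : {ω | ∃ s ∈ D, b s < a ^ (-H) * X (a * s) ω} =
      ⋃ k, {ω | b (ts k) < a ^ (-H) * X (a * ts k) ω} := by
    ext ω; simp [hts]
  have e2 : {ω | ∃ s ∈ D, b s < X s ω} = ⋃ k, {ω | b (ts k) < X (ts k) ω} := by
    ext ω; simp [hts]
  rw [e1, e2, measure_iUnion_eq_iSup_accumulate, measure_iUnion_eq_iSup_accumulate]
  simp only [key]

lemma aux_PD (R : ℝ → ℝ) (hRpos : ∀ u, 0 < R u) (hRanti : Antitone R)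
    (hPD : ∃ l : ℝ, 1 < l ∧ limsup (fun u => R (l * u) / R u) atTop < 1) (ε : ℝ) (hε : 0 < ε) :
    ∃ L : ℝ, 1 ≤ L ∧ ∀ᶠ u in atTop, R (L * u) ≤ ε * R u := by
  obtain ⟨l, hl, hlim⟩ := hPD
  obtain ⟨θ, h1, h2⟩ := exists_between hlim
  have hbd : IsBoundedUnder (· ≤ ·) atTop (fun u => R (l * u) / R u) := by
    refine ⟨1, ?_⟩
    rw [eventually_map]
    filter_upwards [eventually_ge_atTop 0] with u hu
    rw [div_le_one (hRpos u)]
    exact hRanti (by nlinarith)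
  have h3 := eventually_lt_of_limsup_lt h1 hbd
  have hθ : 0 < θ := by
    obtain ⟨u, hu⟩ := h3.exists
    exact lt_trans (div_pos (hRpos _) (hRpos _)) hu
  have h4 : ∀ n : ℕ, ∀ᶠ u in atTop, R (l ^ n * u) ≤ θ ^ n * R u := by
    intro n
    induction n with
    | zero => simp
    | succ n ih =>
      have hT : Tendsto (fun u : ℝ => l ^ n * u) atTop atTop :=
        tendsto_id.const_mul_atTop (by positivity)
      filter_upwards [ih, hT.eventually h3] with u hu hu'
      rw [div_lt_iff₀ (hRpos _)] at hu'
      calc R (l ^ (n+1) * u) = R (l * (l ^ n * u)) := by congr 1; ring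
        _ ≤ θ * R (l ^ n * u) := hu'.le
        _ ≤ θ * (θ ^ n * R u) := by gcongr
        _ = _ := by ring
  obtain ⟨n, hn⟩ := exists_pow_lt_of_lt_one hε h2
  refine ⟨l ^ n, one_le_pow₀ hl.le, ?_⟩
  filter_upwards [h4 n] with u hu
  exact hu.trans (mul_le_mul_of_nonneg_right hn.le (hRpos u).le)

lemma aux_OR (R : ℝ → ℝ) (hRpos : ∀ u, 0 < R u) (hRanti : Antitone R)
    (hOR : ∃ l : ℝ, 1 < l ∧ 0 < liminf (fun u => R (l * u) / R u) atTop) (b : ℝ) :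
    ∃ κ : ℝ, 0 < κ ∧ ∀ᶠ u in atTop, κ * R u ≤ R (b * u) := by
  obtain ⟨l, hl, hlim⟩ := hOR
  obtain ⟨θ, h1, h2⟩ := exists_between hlim
  have hbd : IsBoundedUnder (· ≥ ·) atTop (fun u => R (l * u) / R u) := by
    refine ⟨0, ?_⟩
    rw [eventually_map]
    exact Eventually.of_forall fun u => (div_pos (hRpos _) (hRpos _)).le
  have h3 := eventually_lt_of_lt_liminf h2 hbd
  have h4 : ∀ n : ℕ, ∀ᶠ u in atTop, θ ^ n * R u ≤ R (l ^ n * u) := by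
    intro n
    induction n with
    | zero => simp
    | succ n ih =>
      have hT : Tendsto (fun u : ℝ => l ^ n * u) atTop atTop :=
        tendsto_id.const_mul_atTop (by positivity)
      filter_upwards [ih, hT.eventually h3] with u hu hu'
      rw [lt_div_iff₀ (hRpos _)] at hu'
      calc θ ^ (n+1) * R u = θ * (θ ^ n * R u) := by ring
        _ ≤ θ * R (l ^ n * u) := by gcongr
        _ ≤ R (l * (l ^ n * u)) := hu'.le
        _ = _ := by congr 1; ring
  obtain ⟨n, hn⟩ := pow_unbounded_of_one_lt b hl
  refine ⟨θ ^ n, by positivity, ?_⟩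
  filter_upwards [h4 n, eventually_ge_atTop 0] with u hu h0
  exact hu.trans (hRanti (mul_le_mul_of_nonneg_right hn.le h0))

lemma aux_lim (f : ℝ → ℝ) (h : limsup (fun u : ℝ => ((f u : ℝ) : EReal)) atTop < ⊤) :
    ∃ K : ℝ, 0 < K ∧ ∀ᶠ u in atTop, f u ≤ K := by
  obtain ⟨K, h1, h2⟩ := EReal.lt_iff_exists_real_btwn.1 h
  refine ⟨max K 1, by positivity, ?_⟩
  filter_upwards [eventually_lt_of_limsup_lt h1] with u hu
  exact (EReal.coe_lt_coe_iff.1 hu).le.trans (le_max_left _ _)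

def zz {Ω : Type*} [MeasurableSpace Ω] (P : Measure Ω) (X : ℝ → Ω → ℝ) (c γ v : ℝ) : ℝ :=
  P.real {ω | ∃ s ∈ Ioi (0:ℝ), v * (1 + c * s ^ γ) < X s ω}

lemma aux_ztail {Ω : Type*} [MeasurableSpace Ω] (P : Measure Ω)
    (X : ℝ → Ω → ℝ) (c γ : ℝ) (hc : 0 < c)
    (R : ℝ → ℝ) (hRpos : ∀ u, 0 < R u)
    (hRtail : Tendsto (fun u : ℝ =>
      (P {ω | (u : EReal) < ⨆ s : {s : ℝ // 0 < s},
        (((X (s : ℝ) ω / (1 + c * (s : ℝ) ^ γ) : ℝ) : EReal))}).toReal / R u)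
      atTop (nhds 1)) :
    ∀ᶠ v in atTop, zz P X c γ v ≤ 2 * R v ∧ 3 / 4 * R v ≤ zz P X c γ v := by
  have heq : ∀ u : ℝ, (P {ω | (u : EReal) < ⨆ s : {s : ℝ // 0 < s},
        (((X (s : ℝ) ω / (1 + c * (s : ℝ) ^ γ) : ℝ) : EReal))}).toReal = zz P X c γ u := by
    intro u
    unfold zz Measure.real
    congr 2
    ext ω
    simp only [mem_ofPred_eq, lt_iSup_iff, EReal.coe_lt_coe_iff, Subtype.exists, mem_Ioi]
    refine exists_congr fun s => ?_
    rw [exists_prop]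
    refine and_congr_right fun hs => ?_
    have : 0 < s ^ γ := Real.rpow_pos_of_pos hs γ
    rw [lt_div_iff₀ (by positivity)]
  simp only [heq] at hRtail
  have h1 := hRtail.eventually (Ioo_mem_nhds (show (3/4:ℝ) < 1 by norm_num) (show (1:ℝ) < 2 by norm_num))
  filter_upwards [h1] with v hv
  have := hRpos v
  exact ⟨((div_lt_iff₀ this).1 hv.2).le, ((lt_div_iff₀ this).1 hv.1).le⟩

lemma aux_Q {Ω : Type*} [MeasurableSpace Ω] (P : Measure Ω) [IsProbabilityMeasure P]
    (X : ℝ → Ω → ℝ) (c γ : ℝ) (hc : 0 < c) (hγ : 0 < γ)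
    (hX0 : ∀ᵐ ω ∂P, X 0 ω = 0) (w : ℝ) (hw : 0 < w) :
    P.real {ω | ∃ s ∈ Icc (0:ℝ) 1, w * (1 + c) < X s ω} ≤ zz P X c γ w := by
  refine ENNReal.toReal_mono (measure_ne_top _ _) (measure_mono_ae ?_)
  filter_upwards [hX0] with ω h0
  rintro ⟨s, hs, hlt⟩
  have hs0 : 0 < s := by
    rcases hs.1.lt_or_eq with h | h
    · exact h
    · subst h
      rw [h0] at hlt
      nlinarith
  refine ⟨s, hs0, lt_of_le_of_lt ?_ hlt⟩
  have : s ^ γ ≤ 1 := Real.rpow_le_one hs.1 hs.2 hγ.le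
  gcongr
  nlinarith

lemma aux_lower {Ω : Type*} [MeasurableSpace Ω] (P : Measure Ω) [IsProbabilityMeasure P]
    (X : ℝ → Ω → ℝ) (H c γ : ℝ)
    (hH : 0 < H) (hc : 0 < c) (hγ : H < γ)
    (hm : ∀ s, Measurable (X s))
    (hX0 : ∀ᵐ ω ∂P, X 0 ω = 0)
    (hrc : ∀ᵐ ω ∂P, ∀ t : ℝ, 0 ≤ t → ContinuousWithinAt (fun s => X s ω) (Ici t) t)
    (hss : ∀ a : ℝ, 0 < a → ∀ n : ℕ, ∀ ts : Fin n → ℝ, (∀ i, 0 ≤ ts i) →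
      Measure.map (fun ω (i : Fin n) => a ^ (-H) * X (a * ts i) ω) P =
        Measure.map (fun ω (i : Fin n) => X (ts i) ω) P)
    (R : ℝ → ℝ) (hRpos : ∀ u, 0 < R u) (hRanti : Antitone R)
    (hz : ∀ᶠ v in atTop, zz P X c γ v ≤ 2 * R v ∧ 3 / 4 * R v ≤ zz P X c γ v)
    (hPD : ∃ l : ℝ, 1 < l ∧ limsup (fun u => R (l * u) / R u) atTop < 1) :
    ∃ η N : ℝ, 0 < η ∧ 0 < N ∧ ∀ᶠ v in atTop,
      R v / 2 ≤ P.real {ω | ∃ s ∈ Icc η N, v < X s ω} := by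
  obtain ⟨L, hL, hLR⟩ := aux_PD R hRpos hRanti hPD (1/32) (by norm_num)
  have hγ0 : 0 < γ := hH.trans hγ
  have hL0 : 0 < L := by linarith
  obtain ⟨η, hη, hηH⟩ : ∃ η : ℝ, 0 < η ∧ η ^ H * (L * (1 + c)) = 1 := by
    refine ⟨(L * (1 + c))⁻¹ ^ (1 / H), by positivity, ?_⟩
    rw [← Real.rpow_mul (by positivity), one_div_mul_cancel hH.ne', Real.rpow_one]
    field_simp
  obtain ⟨N, hN, hNH⟩ : ∃ N : ℝ, 0 < N ∧ c * N ^ γ = N ^ H * (L * (1 + c)) := by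
    refine ⟨(L * (1 + c) / c) ^ (1 / (γ - H)), by positivity, ?_⟩
    set N := (L * (1 + c) / c) ^ (1 / (γ - H)) with hN
    have hNpos : 0 < N := by positivity
    have h1 : N ^ (γ - H) = L * (1 + c) / c := by
      rw [hN, ← Real.rpow_mul (by positivity), one_div_mul_cancel (by linarith), Real.rpow_one]
    have h2 : N ^ γ = N ^ (γ - H) * N ^ H := by
      rw [← Real.rpow_add hNpos]; congr 1; ring
    rw [h2, h1]
    field_simp
  refine ⟨η, N, hη, hN, ?_⟩
  have hT : Tendsto (fun u : ℝ => L * u) atTop atTop := tendsto_id.const_mul_atTop hL0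
  filter_upwards [hz, hT.eventually hz, hLR, eventually_gt_atTop 0] with v hv hvL hvR hv0
  have hA : P.real {ω | ∃ s ∈ Icc (0:ℝ) 1, v < X (η * s) ω} ≤ zz P X c γ (L * v) := by
    refine le_trans (le_of_eq ?_) (aux_Q P X c γ hc hγ0 hX0 (L * v) (by positivity))
    have := aux_scale P X H hm hrc hss η hη (Icc 0 1) (fun s hs => hs.1) 1 ?_
      (fun _ => L * v * (1 + c)) continuous_const
    · unfold Measure.real
      rw [← this]
      have e : η ^ H * (L * v * (1 + c)) = v := by linear_combination v * hηH
      simp only [e]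
    · intro s hs
      rcases hs.2.lt_or_eq with h | h
      · exact Or.inr ⟨1, h, fun x hx => ⟨hs.1.trans hx.1.le, hx.2.le⟩⟩
      · exact Or.inl h
  have hC : P.real {ω | ∃ s ∈ Ioi (1:ℝ), N ^ H * (L * v * (1 + c) * s ^ γ) < X (N * s) ω} ≤
      zz P X c γ (L * v) := by
    have := aux_scale P X H hm hrc hss N hN (Ioi 1)
      (fun s hs => zero_le_one.trans (le_of_lt hs)) 1 ?_
      (fun s => L * v * (1 + c) * s ^ γ)
      ((Real.continuous_rpow_const hγ0.le).const_mul _)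
    · unfold Measure.real
      rw [this]
      refine measureReal_mono ?_
      rintro ω ⟨s, hs, hlt⟩
      have hs1 : 1 < s := hs
      refine ⟨s, zero_lt_one.trans hs1, lt_of_le_of_lt ?_ hlt⟩
      have : 1 ≤ s ^ γ := Real.one_le_rpow hs1.le hγ0.le
      rw [mul_assoc (L * v)]
      gcongr
      linarith
    · intro s hs
      exact Or.inr ⟨s + 1, by linarith, fun x hx => lt_trans hs hx.1⟩
  have hcover : zz P X c γ v ≤ P.real {ω | ∃ s ∈ Icc (0:ℝ) 1, v < X (η * s) ω} +
      P.real {ω | ∃ s ∈ Icc η N, v < X s ω} +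
      P.real {ω | ∃ s ∈ Ioi (1:ℝ), N ^ H * (L * v * (1 + c) * s ^ γ) < X (N * s) ω} := by
    refine le_trans (measureReal_mono ?_) ((measureReal_union_le _ _).trans
      (add_le_add_left (measureReal_union_le _ _) _))
    rintro ω ⟨s, hs, hlt⟩
    have hs : 0 < s := hs
    have hsγ : 0 < s ^ γ := Real.rpow_pos_of_pos hs γ
    have hlt1 : v < X s ω := lt_of_le_of_lt (by nlinarith [mul_pos hv0 (mul_pos hc hsγ)]) hlt
    by_cases h1 : s < η
    · refine Or.inl (Or.inl ⟨s / η, ⟨by positivity, ?_⟩, ?_⟩)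
      · rw [div_le_one hη]; exact h1.le
      · rwa [mul_div_cancel₀ _ hη.ne']
    · by_cases h2 : s ≤ N
      · exact Or.inl (Or.inr ⟨s, ⟨not_lt.1 h1, h2⟩, hlt1⟩)
      · refine Or.inr ⟨s / N, ?_, ?_⟩
        · rw [mem_Ioi, one_lt_div hN]; exact not_le.1 h2
        · rw [mul_div_cancel₀ _ hN.ne', Real.div_rpow hs.le hN.le]
          refine lt_of_le_of_lt ?_ hlt
          have e : N ^ H * (L * v * (1 + c) * (s ^ γ / N ^ γ)) = v * (c * s ^ γ) := by
            have : 0 < N ^ γ := Real.rpow_pos_of_pos hN γ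
            field_simp
            linear_combination (-1) * hNH
          rw [e]
          nlinarith
  linarith [hv.2, hvL.1, hvR, hRpos v]

lemma aux_upper {Ω : Type*} [MeasurableSpace Ω] (P : Measure Ω) [IsProbabilityMeasure P]
    (X : ℝ → Ω → ℝ) (H c γ : ℝ)
    (hH : 0 < H) (hc : 0 < c) (hγ : H < γ)
    (hm : ∀ s, Measurable (X s))
    (hX0 : ∀ᵐ ω ∂P, X 0 ω = 0)
    (hrc : ∀ᵐ ω ∂P, ∀ t : ℝ, 0 ≤ t → ContinuousWithinAt (fun s => X s ω) (Ici t) t)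
    (hss : ∀ a : ℝ, 0 < a → ∀ n : ℕ, ∀ ts : Fin n → ℝ, (∀ i, 0 ≤ ts i) →
      Measure.map (fun ω (i : Fin n) => a ^ (-H) * X (a * ts i) ω) P =
        Measure.map (fun ω (i : Fin n) => X (ts i) ω) P)
    (K : ℝ) (hK : 0 < K) :
    ∃ δ : ℝ, 0 < δ ∧ ∀ u m v t : ℝ, 0 < u → 0 < m → 0 < v → 0 < t → m ^ γ = u → m ^ H * v = u →
      t ≤ K * m →
      P.real {ω | ∃ r ∈ Icc 0 t, ∃ s, r ≤ s ∧ u < X s ω - X r ω - c * (s - r) ^ γ} ≤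
        P.real {ω | ∃ r ∈ Icc (0:ℝ) 1, X r ω < - (1/2) * (u / t ^ H)} + zz P X c γ (δ * v) := by
  have hγ0 : 0 < γ := hH.trans hγ
  set A := c * (2 * K) ^ γ with hA
  have hA0 : 0 < A := by positivity
  refine ⟨min (1 / (2 * (1 + A))) (min (1/2) ((1/2) ^ γ)), by positivity, ?_⟩
  set δ := min (1 / (2 * (1 + A))) (min (1/2) ((1/2:ℝ) ^ γ)) with hδ
  have hδ0 : 0 < δ := by positivity
  have hδ1 : δ ≤ 1 / (2 * (1 + A)) := min_le_left _ _
  have hδ2 : δ ≤ 1/2 := (min_le_right _ _).trans (min_le_left _ _)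
  have hδ3 : δ ≤ (1/2) ^ γ := (min_le_right _ _).trans (min_le_right _ _)
  intro u m v t hu hm0 hv ht hmγ hmH htK
  have hneg : P.real {ω | ∃ r ∈ Icc (0:ℝ) 1, X r ω < - (1/2) * (u / t ^ H)} =
      P.real {ω | ∃ r ∈ Icc (0:ℝ) 1, X (t * r) ω < - (1/2) * u} := by
    have := aux_scale P (fun s ω => - X s ω) H (fun s => (hm s).neg) ?_ ?_ t ht (Icc 0 1)
      (fun s hs => hs.1) 1 ?_ (fun _ => (1/2) * (u / t ^ H)) continuous_const
    · unfold Measure.real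
      have htH : 0 < t ^ H := by positivity
      have e : t ^ H * (1 / 2 * (u / t ^ H)) = 1/2 * u := by field_simp
      have e2 : ∀ x : ℝ, 1 / 2 * u < -x ↔ x < -(1 / 2 * u) := fun _ => lt_neg
      have e3 : ∀ x : ℝ, 1 / 2 * (u / t ^ H) < -x ↔ x < -(1 / 2 * (u / t ^ H)) := fun _ => lt_neg
      simp only [e, e2, e3] at this
      simp only [neg_mul, this]
    · filter_upwards [hrc] with ω hω t ht
      exact (hω t ht).neg
    · intro a ha n ts hts
      have h := congrArg (Measure.map (fun x : Fin n → ℝ => -x)) (hss a ha n ts hts)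
      rw [Measure.map_map measurable_neg (measurable_pi_lambda _ fun i => (hm _).const_mul _),
        Measure.map_map measurable_neg (measurable_pi_lambda _ fun i => hm _)] at h
      convert h using 2
      all_goals
        funext ω i
        simp
    · intro s hs
      rcases hs.2.lt_or_eq with h | h
      · exact Or.inr ⟨1, h, fun x hx => ⟨hs.1.trans hx.1.le, hx.2.le⟩⟩
      · exact Or.inl h
  have hzz : zz P X c γ (δ * v) =
      P.real {ω | ∃ s ∈ Ioi (0:ℝ), δ * (u * (1 + c * s ^ γ)) < X (m * s) ω} := by
    have := aux_scale P X H hm hrc hss m hm0 (Ioi 0) (fun s hs => le_of_lt hs) 0 ?_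
      (fun s => δ * v * (1 + c * s ^ γ)) ?_
    · unfold zz Measure.real
      rw [← this]
      have e : ∀ s : ℝ, m ^ H * (δ * v * (1 + c * s ^ γ)) = δ * (u * (1 + c * s ^ γ)) := by
        intro s; rw [← hmH]; ring
      simp only [e]
    · intro s hs
      exact Or.inr ⟨s + 1, by linarith, fun x hx => lt_trans hs hx.1⟩
    · have := Real.continuous_rpow_const hγ0.le
      fun_prop
  rw [hneg, hzz]
  refine le_trans ?_ (measureReal_union_le _ _)
  refine ENNReal.toReal_mono (measure_ne_top _ _) (measure_mono_ae ?_)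
  filter_upwards [hX0] with ω h0
  rintro ⟨r, hr, s, hrs, hlt⟩
  by_cases hXr : X r ω < -(1/2) * u
  · refine Or.inl ⟨r / t, ⟨div_nonneg hr.1 ht.le, ?_⟩, ?_⟩
    · rw [div_le_one ht]; exact hr.2
    · rwa [mul_div_cancel₀ _ ht.ne']
  · have hXr := not_lt.1 hXr
    have hsr : 0 ≤ (s - r) ^ γ := Real.rpow_nonneg (by linarith) _
    have hs0 : 0 ≤ s := hr.1.trans hrs
    have hs : 0 < s := by
      rcases hs0.lt_or_eq with h | h
      · exact h
      · subst h
        rw [h0] at hlt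
        nlinarith
    refine Or.inr ⟨s / m, div_pos hs hm0, ?_⟩
    rw [mul_div_cancel₀ _ hm0.ne', Real.div_rpow hs.le hm0.le, hmγ]
    have e : δ * (u * (1 + c * (s ^ γ / u))) = δ * u + c * (δ * s ^ γ) := by field_simp
    rw [e]
    rcases le_total s (2 * r) with h2 | h2
    · have h3 : s ^ γ ≤ (2 * K) ^ γ * u := by
        rw [← hmγ, ← Real.mul_rpow (by positivity) hm0.le]
        refine Real.rpow_le_rpow hs.le ?_ hγ0.le
        linarith [hr.2]
      have h4 : δ * u + c * (δ * s ^ γ) ≤ δ * ((1 + A) * u) := by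
        have : c * s ^ γ ≤ A * u := by rw [hA, mul_assoc]; gcongr
        nlinarith
      have h5 : δ * ((1 + A) * u) ≤ 1 / (2 * (1 + A)) * ((1 + A) * u) := by gcongr
      have h6 : 1 / (2 * (1 + A)) * ((1 + A) * u) = u / 2 := by field_simp
      nlinarith [mul_nonneg hc.le hsr]
    · have h3 : (1/2) ^ γ * s ^ γ ≤ (s - r) ^ γ := by
        rw [← Real.mul_rpow (by norm_num) hs.le]
        exact Real.rpow_le_rpow (by positivity) (by linarith) hγ0.le
      have h4 : δ * s ^ γ ≤ (s - r) ^ γ :=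
        (mul_le_mul_of_nonneg_right hδ3 (Real.rpow_nonneg hs.le _)).trans h3
      nlinarith [mul_le_mul_of_nonneg_left h4 hc.le]

lemma aux_Ylower {Ω : Type*} [MeasurableSpace Ω] (P : Measure Ω) [IsProbabilityMeasure P]
    (X : ℝ → Ω → ℝ) (H c γ : ℝ)
    (hH : 0 < H) (hc : 0 < c) (hγ : H < γ)
    (hm : ∀ s, Measurable (X s))
    (hX0 : ∀ᵐ ω ∂P, X 0 ω = 0)
    (hrc : ∀ᵐ ω ∂P, ∀ t : ℝ, 0 ≤ t → ContinuousWithinAt (fun s => X s ω) (Ici t) t)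
    (hss : ∀ a : ℝ, 0 < a → ∀ n : ℕ, ∀ ts : Fin n → ℝ, (∀ i, 0 ≤ ts i) →
      Measure.map (fun ω (i : Fin n) => a ^ (-H) * X (a * ts i) ω) P =
        Measure.map (fun ω (i : Fin n) => X (ts i) ω) P)
    (R : ℝ → ℝ) (hRpos : ∀ u, 0 < R u) (hRanti : Antitone R)
    (hz : ∀ᶠ v in atTop, zz P X c γ v ≤ 2 * R v ∧ 3 / 4 * R v ≤ zz P X c γ v)
    (hPD : ∃ l : ℝ, 1 < l ∧ limsup (fun u => R (l * u) / R u) atTop < 1)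
    (K : ℝ) (hK : 0 < K) :
    ∃ b : ℝ, 0 < b ∧ ∀ᶠ v in atTop, ∀ u m th : ℝ, 0 < u → 0 < m → m ^ γ = u → m ^ H * v = u →
      0 ≤ th → th ≤ K * m →
      R (b * v) / 4 ≤
        P.real {ω | ∃ s, th ≤ s ∧ u < X s ω - X th ω - c * (s - th) ^ γ} := by
  have hγ0 : 0 < γ := hH.trans hγ
  obtain ⟨η, N, hη, hN, hlow⟩ :=
    aux_lower P X H c γ hH hc hγ hm hX0 hrc hss R hRpos hRanti hz hPD
  obtain ⟨L, hL, hLR⟩ := aux_PD R hRpos hRanti hPD (1/8) (by norm_num)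
  have hL0 : 0 < L := by linarith
  -- constants
  set k := K ^ H * (1 + c) with hk
  have hk0 : 0 < k := by positivity
  obtain ⟨T, hT0, hT1, hT2⟩ : ∃ T : ℝ, 0 < T ∧ K ≤ η * T ∧ 2 * L * k ≤ T ^ H := by
    have h1 : ∀ᶠ T : ℝ in atTop, 2 * L * k ≤ T ^ H :=
      (tendsto_rpow_atTop hH).eventually_ge_atTop _
    obtain ⟨T, h1, h2, h3⟩ := (h1.and ((eventually_gt_atTop 0).and
      (eventually_ge_atTop (K / η)))).exists
    exact ⟨T, h2, by rwa [div_le_iff₀' hη] at h3, h1⟩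
  have hTH : 0 < T ^ H := by positivity
  set lam := 1 + c * (T * N) ^ γ with hlam
  have hlam0 : 0 < lam := by positivity
  -- w = 1 + lam + c (TN)^γ = 2 lam
  set b := 2 * lam / T ^ H with hb
  have hb0 : 0 < b := by positivity
  have hbL : L * b ≤ lam / k := by
    rw [hb, le_div_iff₀ hk0, ← mul_div_assoc, div_mul_eq_mul_div, div_le_iff₀ hTH]
    nlinarith
  refine ⟨b, hb0, ?_⟩
  have hTb : Tendsto (fun v : ℝ => b * v) atTop atTop := tendsto_id.const_mul_atTop hb0
  have hTl : Tendsto (fun v : ℝ => lam / k * v) atTop atTop :=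
    tendsto_id.const_mul_atTop (by positivity)
  filter_upwards [hTb.eventually hlow, hTb.eventually hLR, hTl.eventually hz,
    eventually_gt_atTop 0] with v h1 h2 h3 hv0 u m th hu hm0 hmγ hmH hth0 hth
  have hTm : 0 < T * m := by positivity
  have hE : P.real {ω | ∃ s ∈ Icc η N, b * v < X s ω} =
      P.real {ω | ∃ s ∈ Icc η N, 2 * lam * u < X (T * m * s) ω} := by
    have := aux_scale P X H hm hrc hss (T * m) hTm (Icc η N) (fun s hs => hη.le.trans hs.1) N ?_
      (fun _ => b * v) continuous_const
    · unfold Measure.real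
      rw [← this]
      have e : (T * m) ^ H * (b * v) = 2 * lam * u := by
        rw [Real.mul_rpow hT0.le hm0.le, ← hmH, hb]
        field_simp
      simp only [e]
    · intro s hs
      rcases hs.2.lt_or_eq with h | h
      · exact Or.inr ⟨N, h, fun x hx => ⟨hs.1.trans hx.1.le, hx.2.le⟩⟩
      · exact Or.inl h
  have hF : P.real {ω | ∃ s ∈ Icc (0:ℝ) 1, lam * u < X (K * m * s) ω} ≤
      zz P X c γ (lam / k * v) := by
    refine le_trans (le_of_eq ?_) (aux_Q P X c γ hc hγ0 hX0 (lam / k * v) (by positivity))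
    have := aux_scale P X H hm hrc hss (K * m) (by positivity) (Icc 0 1) (fun s hs => hs.1) 1 ?_
      (fun _ => lam / k * v * (1 + c)) continuous_const
    · unfold Measure.real
      rw [← this]
      have e : (K * m) ^ H * (lam / k * v * (1 + c)) = lam * u := by
        have : 0 < K ^ H := by positivity
        rw [Real.mul_rpow hK.le hm0.le, ← hmH, hk]
        field_simp
      simp only [e]
    · intro s hs
      rcases hs.2.lt_or_eq with h | h
      · exact Or.inr ⟨1, h, fun x hx => ⟨hs.1.trans hx.1.le, hx.2.le⟩⟩
      · exact Or.inl h
  have hcov : P.real {ω | ∃ s ∈ Icc η N, 2 * lam * u < X (T * m * s) ω} ≤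
      P.real {ω | ∃ s, th ≤ s ∧ u < X s ω - X th ω - c * (s - th) ^ γ} +
      P.real {ω | ∃ s ∈ Icc (0:ℝ) 1, lam * u < X (K * m * s) ω} := by
    refine le_trans (measureReal_mono ?_) (measureReal_union_le _ _)
    rintro ω ⟨s, hs, hlt⟩
    have hKm : 0 < K * m := by positivity
    by_cases hX : lam * u < X th ω
    · refine Or.inr ⟨th / (K * m), ⟨by positivity, ?_⟩, ?_⟩
      · rw [div_le_one hKm]; exact hth
      · rwa [mul_div_cancel₀ _ hKm.ne']
    · have hX := not_lt.1 hX
      have hs0 : 0 < s := hη.trans_le hs.1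
      have h4 : th ≤ T * m * s := by
        calc th ≤ K * m := hth
          _ ≤ η * T * m := by gcongr
          _ ≤ s * T * m := by gcongr; exact hs.1
          _ = _ := by ring
      have h5 : (T * m * s - th) ^ γ ≤ (T * N) ^ γ * u := by
        rw [← hmγ, ← Real.mul_rpow (by positivity) hm0.le]
        refine Real.rpow_le_rpow (by linarith) ?_ hγ0.le
        have : T * m * s ≤ T * m * N := by gcongr; exact hs.2
        linarith
      refine Or.inl ⟨T * m * s, h4, ?_⟩
      have h6 := mul_le_mul_of_nonneg_left h5 hc.le
      have h7 : lam * u = u + c * ((T * N) ^ γ * u) := by rw [hlam]; ring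
      linarith
  have hR1 : R (lam / k * v) ≤ R (L * (b * v)) := by
    apply hRanti
    rw [← mul_assoc]
    gcongr
  linarith [h3.1]

theorem storage_statement_5
    {Ω : Type*} [MeasurableSpace Ω] (P : Measure Ω) [IsProbabilityMeasure P]
    (X : ℝ → Ω → ℝ) (H c γ : ℝ)
    (hH : 0 < H) (hc : 0 < c) (hγ : H < γ)
    (hmeas : Measurable (Function.uncurry X))
    (hX0 : ∀ᵐ ω ∂P, X 0 ω = 0)
    (hpath : ∀ᵐ ω ∂P,
      (∀ t : ℝ, 0 ≤ t → ContinuousWithinAt (fun s => X s ω) (Ici t) t) ∧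
      (∀ T : ℝ, 0 < T → ∃ M : ℝ, ∀ s ∈ Icc (0 : ℝ) T, |X s ω| ≤ M))
    (hss : ∀ a : ℝ, 0 < a → ∀ n : ℕ, ∀ ts : Fin n → ℝ, (∀ i, 0 ≤ ts i) →
      Measure.map (fun ω (i : Fin n) => a ^ (-H) * X (a * ts i) ω) P =
        Measure.map (fun ω (i : Fin n) => X (ts i) ω) P)
    (Y : ℝ → Ω → EReal)
    (hY : ∀ t ω, Y t ω = ⨆ s : {s : ℝ // t ≤ s},
      (((X (s : ℝ) ω - X t ω - c * ((s : ℝ) - t) ^ γ : ℝ) : EReal)))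
    (R : ℝ → ℝ) (hRpos : ∀ u, 0 < R u) (hRanti : Antitone R)
    (hR0 : Tendsto R atTop (nhds 0))
    (hRtail : Tendsto (fun u : ℝ =>
      (P {ω | (u : EReal) < ⨆ s : {s : ℝ // 0 < s},
        (((X (s : ℝ) ω / (1 + c * (s : ℝ) ^ γ) : ℝ) : EReal))}).toReal / R u)
      atTop (nhds 1))
    (hPD : ∃ l : ℝ, 1 < l ∧ limsup (fun u => R (l * u) / R u) atTop < 1)
    (hOR : ∃ l : ℝ, 1 < l ∧ 0 < liminf (fun u => R (l * u) / R u) atTop)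
    (t : ℝ → ℝ) (ht : ∀ u : ℝ, 0 < u → 0 < t u)
    (hgrow : limsup (fun u : ℝ => ((t u / u ^ (1 / γ) : ℝ) : EReal)) atTop < ⊤)
    (hneg : ∀ ε : ℝ, 0 < ε → limsup (fun u : ℝ =>
      (((P {ω | (⨅ s : Icc (0 : ℝ) 1, ((X (s : ℝ) ω : ℝ) : EReal)) <
          ((-ε * (t u * u ^ (-1 / γ)) ^ (-H) * u ^ (1 - H / γ) : ℝ) : EReal)}).toReal /
        R (u ^ (1 - H / γ)) : ℝ) : EReal)) atTop < ⊤)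
        : ∀ th : ℝ → ℝ, (∀ u : ℝ, 0 < u → th u ∈ Icc 0 (t u)) →
      (1 : EReal) ≤ liminf (fun u : ℝ => (((P {ω | (u : EReal) < ⨆ s : Icc (0 : ℝ) (t u), Y (s : ℝ) ω}).toReal / (P {ω | (u : EReal) < Y (th u) ω}).toReal : ℝ) : EReal)) atTop ∧
      limsup (fun u : ℝ => (((P {ω | (u : EReal) < ⨆ s : Icc (0 : ℝ) (t u), Y (s : ℝ) ω}).toReal / (P {ω | (u : EReal) < Y (th u) ω}).toReal : ℝ) : EReal)) atTop < ⊤ := by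
  intro th hth
  have hγ0 : 0 < γ := hH.trans hγ
  have hm : ∀ s, Measurable (X s) := fun s => hmeas.of_uncurry_left
  have hrc : ∀ᵐ ω ∂P, ∀ t : ℝ, 0 ≤ t → ContinuousWithinAt (fun s => X s ω) (Ici t) t :=
    hpath.mono fun ω h => h.1
  have hz := aux_ztail P X c γ hc R hRpos hRtail
  obtain ⟨K, hK, hKt⟩ := aux_lim _ hgrow
  obtain ⟨C, hC, hCn⟩ := aux_lim _ (hneg (1/2) (by norm_num))
  obtain ⟨δ, hδ, hup⟩ := aux_upper P X H c γ hH hc hγ hm hX0 hrc hss K hK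
  obtain ⟨b, hb, hlow⟩ :=
    aux_Ylower P X H c γ hH hc hγ hm hX0 hrc hss R hRpos hRanti hz hPD K hK
  obtain ⟨κ, hκ, hκR⟩ := aux_OR R hRpos hRanti hOR b
  obtain ⟨κ', hκ', hκR'⟩ := aux_OR R hRpos hRanti hOR (1/δ)
  have hV : Tendsto (fun u : ℝ => u ^ (1 - H / γ)) atTop atTop :=
    tendsto_rpow_atTop (by rw [sub_pos, div_lt_one hγ0]; exact hγ)
  have hVδ : Tendsto (fun u : ℝ => δ * u ^ (1 - H / γ)) atTop atTop :=
    hV.const_mul_atTop hδ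
  have hsetS : ∀ u : ℝ, {ω | (u : EReal) < ⨆ s : Icc (0 : ℝ) (t u), Y (s : ℝ) ω} =
      {ω | ∃ r ∈ Icc 0 (t u), ∃ s, r ≤ s ∧ u < X s ω - X r ω - c * (s - r) ^ γ} := by
    intro u
    ext ω
    simp only [mem_ofPred_eq, lt_iSup_iff, hY, EReal.coe_lt_coe_iff, Subtype.exists, exists_prop]
  have hsetY : ∀ u : ℝ, {ω | (u : EReal) < Y (th u) ω} =
      {ω | ∃ s, th u ≤ s ∧ u < X s ω - X (th u) ω - c * (s - th u) ^ γ} := by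
    intro u
    ext ω
    simp only [mem_ofPred_eq, lt_iSup_iff, hY, EReal.coe_lt_coe_iff, Subtype.exists, exists_prop]
  have main : ∀ᶠ u : ℝ in atTop,
      κ / 4 * R (u ^ (1 - H / γ)) ≤ P.real {ω | (u : EReal) < Y (th u) ω} ∧
      P.real {ω | (u : EReal) < Y (th u) ω} ≤
        P.real {ω | (u : EReal) < ⨆ s : Icc (0 : ℝ) (t u), Y (s : ℝ) ω} ∧
      P.real {ω | (u : EReal) < ⨆ s : Icc (0 : ℝ) (t u), Y (s : ℝ) ω} ≤
        (C + 2 / κ') * R (u ^ (1 - H / γ)) := by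
    filter_upwards [hKt, hCn, hV.eventually hlow, hV.eventually hκR, hVδ.eventually hκR',
      hVδ.eventually hz, eventually_gt_atTop 0] with u h1 h2 h3 h4 h5 h6 hu
    have ht0 := ht u hu
    have hthu := hth u hu
    set m := u ^ (1 / γ) with hmdef
    set v := u ^ (1 - H / γ) with hvdef
    have hm0 : 0 < m := by positivity
    have hv0 : 0 < v := by positivity
    have hmγ : m ^ γ = u := by
      rw [hmdef, ← Real.rpow_mul hu.le, one_div_mul_cancel hγ0.ne', Real.rpow_one]
    have hmH : m ^ H * v = u := by
      rw [hmdef, hvdef, ← Real.rpow_mul hu.le, ← Real.rpow_add hu]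
      conv_rhs => rw [← Real.rpow_one u]
      congr 1
      ring
    have htK : t u ≤ K * m := by rwa [div_le_iff₀ hm0] at h1
    have hthr : -(1/2) * (t u * u ^ (-1 / γ)) ^ (-H) * v = -(1/2) * (u / t u ^ H) := by
      have e1 : u ^ (-1 / γ) = m⁻¹ := by
        rw [hmdef, ← Real.rpow_neg hu.le]; congr 1; ring
      have hmH0 : 0 < m ^ H := by positivity
      have htH0 : 0 < t u ^ H := by positivity
      rw [e1, Real.mul_rpow ht0.le (by positivity), Real.rpow_neg ht0.le,
        Real.rpow_neg (by positivity), Real.inv_rpow hm0.le, inv_inv, ← hmH]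
      field_simp
    have hsetN : {ω | (⨅ s : Icc (0 : ℝ) 1, ((X (s : ℝ) ω : ℝ) : EReal)) <
          ((-(1/2) * (t u * u ^ (-1 / γ)) ^ (-H) * v : ℝ) : EReal)} =
        {ω | ∃ r ∈ Icc (0:ℝ) 1, X r ω < - (1/2) * (u / t u ^ H)} := by
      rw [hthr]
      ext ω
      simp only [mem_ofPred_eq, iInf_lt_iff, EReal.coe_lt_coe_iff, Subtype.exists, exists_prop]
    rw [hsetN, div_le_iff₀ (hRpos v), ← measureReal_def] at h2
    refine ⟨?_, ?_, ?_⟩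
    · rw [hsetY]
      have := h3 u m (th u) hu hm0 hmγ hmH hthu.1 (hthu.2.trans htK)
      linarith
    · refine measureReal_mono ?_
      intro ω hω
      exact lt_of_lt_of_le hω (le_iSup (fun s : Icc (0 : ℝ) (t u) => Y (s : ℝ) ω) ⟨th u, hthu⟩)
    · rw [hsetS]
      have h7 := hup u m v (t u) hu hm0 hv0 ht0 hmγ hmH htK
      have e : 1 / δ * (δ * v) = v := by field_simp
      rw [e] at h5
      have h8 : R (δ * v) ≤ R v / κ' := by rw [le_div_iff₀ hκ']; linarith
      have h9 : (C + 2 / κ') * R v = C * R v + 2 * (R v / κ') := by ring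
      linarith [h6.1]
  constructor
  · refine le_liminf_of_le (by isBoundedDefault) ?_
    filter_upwards [main] with u hu
    have h0 : 0 < P.real {ω | (u : EReal) < Y (th u) ω} :=
      lt_of_lt_of_le (by have := hRpos (u ^ (1 - H / γ)); positivity) hu.1
    rw [← EReal.coe_one, EReal.coe_le_coe_iff]
    exact (one_le_div h0).2 hu.2.1
  · refine lt_of_le_of_lt (b := (((C + 2 / κ') / (κ / 4) : ℝ) : EReal)) ?_ (EReal.coe_lt_top _)
    refine limsup_le_of_le (by isBoundedDefault) ?_
    filter_upwards [main] with u hu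
    have hR := hRpos (u ^ (1 - H / γ))
    have h0 : 0 < P.real {ω | (u : EReal) < Y (th u) ω} :=
      lt_of_lt_of_le (by positivity) hu.1
    rw [EReal.coe_le_coe_iff]
    refine (div_le_iff₀ h0).2 (hu.2.2.trans ?_)
    calc (C + 2 / κ') * R (u ^ (1 - H / γ))
        = (C + 2 / κ') / (κ / 4) * (κ / 4 * R (u ^ (1 - H / γ))) := by field_simp
      _ ≤ _ := by gcongr; exact hu.1
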